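/- arXiv:math-ph/0409028 — 4 statements merged into one kernel-verified Lean document; each statement's English description precedes it below -/
import Mathlib

section
/- Let ψ be the Lévy characteristic associated with the triplet (a, σ, M). Let d, n ≥ 1 and let f_1, …, f_n : ℝ^d → ℝ^L be measurable functions such that for every pair (l, j) the function x ↦ ψ(f_l(x) − f_j(x)) is integrable on ℝ^d. Then the n×n complex matrix with entries C_{lj} = exp(∫_{ℝ^d} ψ(f_l(x) − f_j(x)) dx) is positive semidefinite, i.e. for all z_1, …, z_n ∈ ℂ the sum Σ_{l,j=1}^n conj(z_l) · C_{lj} · z_j is a nonnegative real number. -/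
open MeasureTheory Complex ComplexOrder

/-- The Lévy characteristic associated with the triplet `(a, σ, M)`:
`ψ(t) = i a·t − (σt·σt)/2 + ∫ (e^{i t·s} − 1) dM(s)`. -/
noncomputable def levyChar (L : ℕ) (a : Fin L → ℝ) (σ : Matrix (Fin L) (Fin L) ℝ)
    (M : Measure (Fin L → ℝ)) (t : Fin L → ℝ) : ℂ :=
  Complex.I * ((∑ i, a i * t i : ℝ) : ℂ) -
    (((∑ i, σ.mulVec t i * σ.mulVec t i) / 2 : ℝ) : ℂ) +
    ∫ s, (Complex.exp (Complex.I * ((∑ i, t i * s i : ℝ) : ℂ)) - 1) ∂M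

open Matrix in
/-- The entrywise exponential of a positive semidefinite matrix is positive semidefinite. -/
theorem Matrix.PosSemidef.map_exp {ι : Type*} [Fintype ι] {K : Matrix ι ι ℂ}
    (hK : K.PosSemidef) : (K.map Complex.exp).PosSemidef := by
  have hpow (k : ℕ) : (K.map (· ^ k)).PosSemidef := by
    induction k with
    | zero =>
      have h : K.map (· ^ 0) = vecMulVec (1 : ι → ℂ) (star 1) := by
        ext; simp [vecMulVec_apply]
      rw [h]
      exact posSemidef_vecMulVec_self_star _
    | succ k ih =>
      have h : K.map (· ^ (k + 1)) = K.map (· ^ k) ⊙ K := by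
        ext; simp [pow_succ]
      rw [h]
      exact ih.hadamard hK
  refine posSemidef_iff_dotProduct_mulVec.mpr ⟨?_, fun x => ?_⟩
  · ext i j
    simp [← Complex.exp_conj, ← hK.isHermitian.apply i j]
  · have hsum (w : ℂ) : HasSum (fun k : ℕ => w ^ k / (k.factorial : ℂ)) (Complex.exp w) := by
      rw [Complex.exp_eq_exp_ℂ]
      exact NormedSpace.expSeries_div_hasSum_exp w
    have h : HasSum (fun k : ℕ => (k.factorial : ℂ)⁻¹ * (star x ⬝ᵥ (K.map (· ^ k) *ᵥ x)))
        (star x ⬝ᵥ (K.map Complex.exp *ᵥ x)) := by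
      simp only [dotProduct, mulVec, Finset.mul_sum, map_apply]
      refine hasSum_sum fun i _ => hasSum_sum fun j _ => ?_
      convert! ((hsum (K i j)).mul_right (x j)).mul_left (star x i) using 1
      ext k
      ring
    refine h.nonneg fun k => mul_nonneg ?_ ((hpow k).dotProduct_mulVec_nonneg x)
    rw [← Complex.ofReal_natCast, ← Complex.ofReal_inv]
    exact Complex.zero_le_real.mpr (by positivity)

theorem sum_star_mul_mul_star_mul_nonneg {ι : Type*} [Fintype ι] (c z : ι → ℂ) :
    0 ≤ ∑ l, ∑ j, starRingEnd ℂ (z l) * (c l * starRingEnd ℂ (c j)) * z j := by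
  have h : ∑ l, ∑ j, starRingEnd ℂ (z l) * (c l * starRingEnd ℂ (c j)) * z j =
      (∑ l, starRingEnd ℂ (z l) * c l) * star (∑ l, starRingEnd ℂ (z l) * c l) := by
    simp only [star_sum, Finset.sum_mul_sum]
    refine Finset.sum_congr rfl fun l _ => Finset.sum_congr rfl fun j _ => ?_
    simp
    ring
  rw [h]
  exact mul_star_self_nonneg _

theorem integral_sub_sub {α : Type*} [MeasurableSpace α] {μ : Measure α} {f g h : α → ℂ}
    (hf : Integrable f μ) (hg : Integrable g μ) (hh : Integrable h μ) :
    ∫ x, f x - g x - h x ∂μ = ∫ x, f x ∂μ - ∫ x, g x ∂μ - ∫ x, h x ∂μ :=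
  (integral_sub (hf.sub hg) hh).trans (congrArg (· - _) (integral_sub hf hg))

section LevyChar

variable {L : ℕ} (a : Fin L → ℝ) (σ : Matrix (Fin L) (Fin L) ℝ) {M : Measure (Fin L → ℝ)}

theorem levyChar_neg (t : Fin L → ℝ) :
    levyChar L a σ M (-t) = starRingEnd ℂ (levyChar L a σ M t) := by
  simp only [levyChar, map_add, map_sub, map_mul, Complex.conj_ofReal, Complex.conj_I,
    ← integral_conj, ← Complex.exp_conj, map_one, Matrix.mulVec_neg, Pi.neg_apply,
    mul_neg, neg_mul, neg_neg, Finset.sum_neg_distrib, Complex.ofReal_neg]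

/-- The function `s ↦ e^{i t·s} − 1` integrated in the jump part of `levyChar`. -/
noncomputable def expSubOne (t s : Fin L → ℝ) : ℂ :=
  Complex.exp (Complex.I * ((∑ i, t i * s i : ℝ) : ℂ)) - 1

theorem continuous_expSubOne (t : Fin L → ℝ) : Continuous (expSubOne t) := by
  unfold expSubOne
  fun_prop

theorem integrable_expSubOne (hM : Integrable (fun s => ‖s‖) M) (t : Fin L → ℝ) :
    Integrable (expSubOne t) M := by
  refine (hM.const_mul (∑ i, |t i|)).mono' (continuous_expSubOne t).aestronglyMeasurable
    (.of_forall fun s => Real.norm_exp_I_mul_ofReal_sub_one_le.trans ?_)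
  rw [Finset.sum_mul]
  refine (Finset.abs_sum_le_sum_abs _ _).trans (Finset.sum_le_sum fun i _ => ?_)
  rw [abs_mul]
  exact mul_le_mul_of_nonneg_left (norm_le_pi_norm s i) (abs_nonneg _)

theorem expSubOne_mul_conj (t r s : Fin L → ℝ) :
    expSubOne t s * starRingEnd ℂ (expSubOne r s) =
      expSubOne (t - r) s - expSubOne t s - expSubOne (-r) s := by
  have h : Complex.exp (Complex.I * ((∑ i, (t - r) i * s i : ℝ) : ℂ)) =
      Complex.exp (Complex.I * ((∑ i, t i * s i : ℝ) : ℂ)) *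
        Complex.exp (-(Complex.I * ((∑ i, r i * s i : ℝ) : ℂ))) := by
    rw [← Complex.exp_add]
    congr 1
    simp only [Pi.sub_apply, sub_mul, Finset.sum_sub_distrib, Complex.ofReal_sub]
    ring
  simp only [expSubOne, h, map_sub, map_one, ← Complex.exp_conj, map_mul, Complex.conj_I,
    Complex.conj_ofReal, Pi.neg_apply, neg_mul, Finset.sum_neg_distrib, Complex.ofReal_neg,
    mul_neg]
  ring

theorem integrable_expSubOne_mul_conj (hM : Integrable (fun s => ‖s‖) M) (t r : Fin L → ℝ) :
    Integrable (fun s => expSubOne t s * starRingEnd ℂ (expSubOne r s)) M := by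
  simp only [expSubOne_mul_conj]
  exact ((integrable_expSubOne hM _).sub (integrable_expSubOne hM _)).sub
    (integrable_expSubOne hM _)

theorem levyChar_sub_sub_sub (hM : Integrable (fun s => ‖s‖) M) (t r : Fin L → ℝ) :
    levyChar L a σ M (t - r) - levyChar L a σ M t - levyChar L a σ M (-r) =
      ∑ i, (σ.mulVec t i : ℂ) * starRingEnd ℂ (σ.mulVec r i : ℂ) +
        ∫ s, expSubOne t s * starRingEnd ℂ (expSubOne r s) ∂M := by
  have hjump : ∫ s, expSubOne t s * starRingEnd ℂ (expSubOne r s) ∂M =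
      ∫ s, expSubOne (t - r) s ∂M - ∫ s, expSubOne t s ∂M - ∫ s, expSubOne (-r) s ∂M := by
    simp only [expSubOne_mul_conj]
    exact integral_sub_sub (integrable_expSubOne hM _) (integrable_expSubOne hM _)
      (integrable_expSubOne hM _)
  have hdrift : ∑ i, a i * (t - r) i = ∑ i, a i * t i + ∑ i, a i * (-r) i := by
    simp [sub_eq_add_neg, mul_add, Finset.sum_add_distrib]
  have hgauss : ∑ i, σ.mulVec (t - r) i * σ.mulVec (t - r) i =
      ∑ i, σ.mulVec t i * σ.mulVec t i + ∑ i, σ.mulVec (-r) i * σ.mulVec (-r) i -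
        2 * ∑ i, σ.mulVec t i * σ.mulVec r i := by
    rw [Finset.mul_sum, ← Finset.sum_add_distrib, ← Finset.sum_sub_distrib]
    refine Finset.sum_congr rfl fun i _ => ?_
    simp only [Matrix.mulVec_sub, Matrix.mulVec_neg, Pi.sub_apply, Pi.neg_apply]
    ring
  rw [hjump]
  simp only [levyChar, hdrift, hgauss, expSubOne]
  simp only [Complex.conj_ofReal]
  simp only [Complex.ofReal_add, Complex.ofReal_sub, Complex.ofReal_div, Complex.ofReal_mul 2,
    ← Complex.ofReal_mul, ← Complex.ofReal_sum, Complex.ofReal_ofNat]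
  ring

/-- `ψ` is conditionally positive definite: the kernel `ψ(t − r) − ψ(t) − ψ(−r)` is positive
definite. -/
theorem levyChar_sum_nonneg (hM : Integrable (fun s => ‖s‖) M) {ι : Type*} [Fintype ι]
    (t : ι → Fin L → ℝ) (z : ι → ℂ) :
    0 ≤ ∑ l, ∑ j, starRingEnd ℂ (z l) *
      (levyChar L a σ M (t l - t j) - levyChar L a σ M (t l) - levyChar L a σ M (-t j)) * z j := by
  have hgauss : 0 ≤ ∑ l, ∑ j, starRingEnd ℂ (z l) *
      (∑ i, (σ.mulVec (t l) i : ℂ) * starRingEnd ℂ (σ.mulVec (t j) i : ℂ)) * z j := by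
    have h : ∑ l, ∑ j, starRingEnd ℂ (z l) *
        (∑ i, (σ.mulVec (t l) i : ℂ) * starRingEnd ℂ (σ.mulVec (t j) i : ℂ)) * z j =
        ∑ i, ∑ l, ∑ j, starRingEnd ℂ (z l) *
          ((σ.mulVec (t l) i : ℂ) * starRingEnd ℂ (σ.mulVec (t j) i : ℂ)) * z j := by
      simp only [Finset.mul_sum, Finset.sum_mul]
      rw [Finset.sum_comm]
      conv_rhs => rw [Finset.sum_comm]; enter [2, l]; rw [Finset.sum_comm]
      rw [Finset.sum_comm]
    rw [h]
    exact Finset.sum_nonneg fun i _ =>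
      sum_star_mul_mul_star_mul_nonneg (fun l => (σ.mulVec (t l) i : ℂ)) z
  have hjump : 0 ≤ ∑ l, ∑ j, starRingEnd ℂ (z l) *
      (∫ s, expSubOne (t l) s * starRingEnd ℂ (expSubOne (t j) s) ∂M) * z j := by
    have hi (l j : ι) : Integrable (fun s => starRingEnd ℂ (z l) *
        (expSubOne (t l) s * starRingEnd ℂ (expSubOne (t j) s)) * z j) M :=
      ((integrable_expSubOne_mul_conj hM _ _).const_mul _).mul_const _
    simp only [← integral_const_mul, ← integral_mul_const]
    simp only [← integral_finsetSum _ fun j _ => hi _ j]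
    rw [← integral_finsetSum _ fun l _ => integrable_finsetSum _ fun j _ => hi l j]
    exact integral_nonneg fun s =>
      sum_star_mul_mul_star_mul_nonneg (fun l => expSubOne (t l) s) z
  simp only [levyChar_sub_sub_sub a σ hM, mul_add, add_mul, Finset.sum_add_distrib]
  exact add_nonneg hgauss hjump

end LevyChar

/-- The matrix `C_{lj} = exp (∫ ψ(f_l(x) − f_j(x)) dx)` is positive semidefinite. -/
theorem positive_definiteness_of_characteristic_functional
    (L d n : ℕ) (hL : 1 ≤ L) (hd : 1 ≤ d) (hn : 1 ≤ n)
    (a : Fin L → ℝ) (σ : Matrix (Fin L) (Fin L) ℝ)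
    (hσsymm : σ.IsSymm) (hσpos : σ.PosSemidef)
    (M : Measure (Fin L → ℝ)) (hM0 : M {0} = 0)
    (hMmom : ∀ k : ℕ, 1 ≤ k → Integrable (fun s => ‖s‖ ^ k) M)
    (f : Fin n → (Fin d → ℝ) → (Fin L → ℝ))
    (hf : ∀ l, Measurable (f l))
    (hint : ∀ l j : Fin n,
      Integrable (fun x => levyChar L a σ M (f l x - f j x))
        (volume : Measure (Fin d → ℝ)))
    (z : Fin n → ℂ) :
    0 ≤ ∑ l : Fin n, ∑ j : Fin n,
      (starRingEnd ℂ) (z l) *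
        Complex.exp (∫ x, levyChar L a σ M (f l x - f j x)
          ∂(volume : Measure (Fin d → ℝ))) * z j := by
  have hM : Integrable (fun s => ‖s‖) M := by simpa using hMmom 1 le_rfl
  set o : Fin n := ⟨0, hn⟩
  set G : Fin n → Fin n → ℂ := fun l j => ∫ x, levyChar L a σ M (f l x - f j x) with hG
  have hGconj (l j : Fin n) : G j l = starRingEnd ℂ (G l j) := by
    simp only [hG, ← integral_conj, ← levyChar_neg, neg_sub]
  let K : Matrix (Fin n) (Fin n) ℂ := .of fun l j => G l j - G l o - G o j
  have hK : K.PosSemidef := by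
    refine Matrix.posSemidef_iff_dotProduct_mulVec.mpr ⟨?_, fun x => ?_⟩
    · ext l j
      simp only [K, Matrix.conjTranspose_apply, Matrix.of_apply, star_sub, RCLike.star_def,
        ← hGconj]
      ring
    · have hi (l j : Fin n) : Integrable (fun y => starRingEnd ℂ (x l) *
          (levyChar L a σ M (f l y - f j y) - levyChar L a σ M (f l y - f o y) -
            levyChar L a σ M (f o y - f j y)) * x j) :=
        ((((hint l j).sub (hint l o)).sub (hint o j)).const_mul _).mul_const _
      have h : star x ⬝ᵥ K.mulVec x = ∫ y, ∑ l, ∑ j, starRingEnd ℂ (x l) *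
          (levyChar L a σ M (f l y - f j y) - levyChar L a σ M (f l y - f o y) -
            levyChar L a σ M (f o y - f j y)) * x j := by
        rw [integral_finsetSum _ fun l _ => integrable_finsetSum _ fun j _ => hi l j]
        simp only [integral_finsetSum _ fun j _ => hi _ j, integral_const_mul,
          integral_mul_const, dotProduct, Matrix.mulVec, Finset.mul_sum]
        refine Finset.sum_congr rfl fun l _ => Finset.sum_congr rfl fun j _ => ?_
        rw [integral_sub_sub (hint l j) (hint l o) (hint o j)]
        simp only [K, hG, Matrix.of_apply, Pi.star_apply, RCLike.star_def]
        ring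
      rw [h]
      refine integral_nonneg fun y => ?_
      simpa using levyChar_sum_nonneg a σ hM (fun l => f l y - f o y) x
  have h := hK.map_exp.dotProduct_mulVec_nonneg fun j => Complex.exp (G o j) * z j
  convert h using 1
  simp only [dotProduct, Matrix.mulVec, Finset.mul_sum]
  refine Finset.sum_congr rfl fun l _ => Finset.sum_congr rfl fun j _ => ?_
  have hexp : Complex.exp (G l j) =
      Complex.exp (G l o) * Complex.exp (K l j) * Complex.exp (G o j) := by
    rw [← Complex.exp_add, ← Complex.exp_add]
    congr 1
    simp only [K, Matrix.of_apply]
    ring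
  simp only [Pi.star_apply, RCLike.star_def, map_mul, ← Complex.exp_conj, ← hGconj,
    Matrix.map_apply]
  rw [hexp]
  ring
end

section
/- Let ψ be the Lévy characteristic associated with the triplet (a, σ, M). Then ψ is conditionally positive definite: for every n ≥ 1, all t_1, …, t_n ∈ ℝ^L and all z_1, …, z_n ∈ ℂ with Σ_{j=1}^n z_j = 0, the sum Σ_{l,j=1}^n ψ(t_l − t_j) · z_l · conj(z_j) is a nonnegative real number. -/
open MeasureTheory Complex ComplexOrder

section KernelSums

variable {ι : Type*} [Fintype ι] {z : ι → ℂ}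

theorem sum_mul_left_kernel_eq_zero (hz : ∑ j, z j = 0) (f : ι → ℂ) :
    ∑ l, ∑ j, f l * z l * (starRingEnd ℂ) (z j) = 0 := by
  simp_rw [← Finset.mul_sum, ← map_sum, hz, map_zero, mul_zero, Finset.sum_const_zero]

theorem sum_mul_right_kernel_eq_zero (hz : ∑ j, z j = 0) (f : ι → ℂ) :
    ∑ l, ∑ j, f j * z l * (starRingEnd ℂ) (z j) = 0 := by
  rw [Finset.sum_comm]
  simp_rw [← Finset.sum_mul, ← Finset.mul_sum, hz, mul_zero, zero_mul, Finset.sum_const_zero]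

theorem sum_mul_conj_kernel_nonneg (z f : ι → ℂ) :
    0 ≤ ∑ l, ∑ j, f l * (starRingEnd ℂ) (f j) * z l * (starRingEnd ℂ) (z j) := by
  have h : ∑ l, ∑ j, f l * (starRingEnd ℂ) (f j) * z l * (starRingEnd ℂ) (z j) =
      (∑ l, f l * z l) * (starRingEnd ℂ) (∑ l, f l * z l) := by
    rw [map_sum, Finset.sum_mul_sum]
    refine Finset.sum_congr rfl fun l _ => Finset.sum_congr rfl fun j _ => ?_
    rw [map_mul]
    ring
  rw [h, Complex.mul_conj]
  exact_mod_cast Complex.normSq_nonneg _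

theorem sum_sub_kernel_eq_zero (hz : ∑ j, z j = 0) (f : ι → ℂ) :
    ∑ l, ∑ j, (f l - f j) * z l * (starRingEnd ℂ) (z j) = 0 := by
  simp_rw [sub_mul, Finset.sum_sub_distrib]
  rw [sum_mul_left_kernel_eq_zero hz, sum_mul_right_kernel_eq_zero hz, sub_zero]

theorem sum_neg_sq_sub_kernel_nonneg (hz : ∑ j, z j = 0) (x : ι → ℝ) :
    0 ≤ ∑ l, ∑ j, (-((x l - x j) ^ 2 / 2 : ℝ) : ℂ) * z l * (starRingEnd ℂ) (z j) := by
  have h : ∀ l j, (-((x l - x j) ^ 2 / 2 : ℝ) : ℂ) * z l * (starRingEnd ℂ) (z j) =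
      (x l : ℂ) * (starRingEnd ℂ) (x j : ℂ) * z l * (starRingEnd ℂ) (z j) -
      ((x l : ℂ) ^ 2 / 2) * z l * (starRingEnd ℂ) (z j) -
      ((x j : ℂ) ^ 2 / 2) * z l * (starRingEnd ℂ) (z j) := by
    intro l j
    rw [Complex.conj_ofReal]
    push_cast
    ring
  simp_rw [h, Finset.sum_sub_distrib]
  rw [sum_mul_left_kernel_eq_zero hz (fun l => (x l : ℂ) ^ 2 / 2),
    sum_mul_right_kernel_eq_zero hz (fun l => (x l : ℂ) ^ 2 / 2), sub_zero, sub_zero]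
  exact sum_mul_conj_kernel_nonneg z fun l => (x l : ℂ)

theorem sum_exp_sub_one_kernel_nonneg (hz : ∑ j, z j = 0) (x : ι → ℝ) :
    0 ≤ ∑ l, ∑ j, (Complex.exp (Complex.I * ((x l - x j : ℝ) : ℂ)) - 1) * z l *
      (starRingEnd ℂ) (z j) := by
  have h : ∀ l j, Complex.exp (Complex.I * ((x l - x j : ℝ) : ℂ)) =
      Complex.exp (Complex.I * x l) * (starRingEnd ℂ) (Complex.exp (Complex.I * x j)) := by
    intro l j
    rw [← Complex.exp_conj, ← Complex.exp_add, map_mul, Complex.conj_I, Complex.conj_ofReal]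
    push_cast
    ring_nf
  simp_rw [h, sub_mul, Finset.sum_sub_distrib]
  rw [sum_mul_left_kernel_eq_zero hz (fun _ => 1), sub_zero]
  exact sum_mul_conj_kernel_nonneg z fun l => Complex.exp (Complex.I * x l)

end KernelSums

theorem integrable_exp_dotProduct_sub_one {ι : Type*} [Fintype ι] {M : Measure (ι → ℝ)}
    (hM : Integrable (fun s => ‖s‖) M) (t : ι → ℝ) :
    Integrable (fun s => Complex.exp (Complex.I * ((∑ i, t i * s i : ℝ) : ℂ)) - 1) M := by
  refine (hM.const_mul (∑ i, ‖t i‖)).mono'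
    (Continuous.measurable (by fun_prop)).aestronglyMeasurable (.of_forall fun s => ?_)
  refine (Real.norm_exp_I_mul_ofReal_sub_one_le).trans ?_
  rw [Finset.sum_mul]
  refine (norm_sum_le _ _).trans (Finset.sum_le_sum fun i _ => ?_)
  rw [norm_mul]
  gcongr
  exact norm_le_pi_norm s i

/-- The Lévy characteristic `ψ` is conditionally positive definite:
for `z_1, …, z_n` with `Σ z_j = 0`, `Σ_{l,j} ψ(t_l − t_j) z_l conj(z_j) ≥ 0`. -/
theorem levyChar_conditionally_positive_definite
    (L : ℕ) (hL : 1 ≤ L)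
    (a : Fin L → ℝ) (σ : Matrix (Fin L) (Fin L) ℝ)
    (hσsymm : σ.IsSymm) (hσpos : σ.PosSemidef)
    (M : Measure (Fin L → ℝ)) (hM0 : M {0} = 0)
    (hMmom : ∀ k : ℕ, 1 ≤ k → Integrable (fun s => ‖s‖ ^ k) M)
    (n : ℕ) (hn : 1 ≤ n) (t : Fin n → (Fin L → ℝ))
    (z : Fin n → ℂ) (hz : ∑ j, z j = 0) :
    0 ≤ ∑ l : Fin n, ∑ j : Fin n,
      levyChar L a σ M (t l - t j) * z l * (starRingEnd ℂ) (z j) := by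
  have hM : Integrable (fun s => ‖s‖) M := by simpa using hMmom 1 le_rfl
  simp_rw [levyChar, add_mul, sub_eq_add_neg (Complex.I * _), add_mul, Finset.sum_add_distrib]
  refine add_nonneg (add_nonneg ?_ ?_) ?_
  · refine (Eq.symm ?_).le
    rw [← sum_sub_kernel_eq_zero hz fun l => Complex.I * ((∑ i, a i * t l i : ℝ) : ℂ)]
    simp_rw [← mul_sub, ← Complex.ofReal_sub, ← Finset.sum_sub_distrib, ← mul_sub, Pi.sub_apply]
  · have h : ∀ l j, -(((∑ i, σ.mulVec (t l - t j) i * σ.mulVec (t l - t j) i) / 2 : ℝ) : ℂ) *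
        z l * (starRingEnd ℂ) (z j) =
        ∑ i, (-((σ.mulVec (t l) i - σ.mulVec (t j) i) ^ 2 / 2 : ℝ) : ℂ) * z l *
          (starRingEnd ℂ) (z j) := by
      intro l j
      simp_rw [← Finset.sum_mul, Finset.sum_neg_distrib, ← Complex.ofReal_sum, Finset.sum_div,
        Matrix.mulVec_sub, Pi.sub_apply, sq]
    simp_rw [h]
    rw [Finset.sum_congr rfl fun l _ => Finset.sum_comm, Finset.sum_comm]
    exact Finset.sum_nonneg fun i _ => sum_neg_sq_sub_kernel_nonneg hz fun l => σ.mulVec (t l) i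
  · have hint : ∀ l j, Integrable (fun s => (Complex.exp (Complex.I *
        ((∑ i, (t l - t j) i * s i : ℝ) : ℂ)) - 1) * z l * (starRingEnd ℂ) (z j)) M := fun l j =>
      ((integrable_exp_dotProduct_sub_one hM (t l - t j)).mul_const _).mul_const _
    simp_rw [← integral_mul_const]
    rw [Finset.sum_congr rfl fun l _ => (integral_finsetSum _ fun j _ => hint l j).symm,
      ← integral_finsetSum _ fun l _ => integrable_finsetSum _ fun j _ => hint l j]
    refine integral_nonneg fun s => ?_
    simp_rw [Pi.sub_apply, sub_mul (t _ _), Finset.sum_sub_distrib]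
    exact sum_exp_sub_one_kernel_nonneg hz fun l => ∑ i, t l i * s i
end

section
/- Let n ≥ 1 and let A be an n×n complex matrix which is Hermitian (A_{jl} = conj(A_{lj}) for all l, j) and conditionally positive semidefinite, i.e. for all z_1, …, z_n ∈ ℂ with Σ_{j=1}^n z_j = 0 one has Σ_{l,j=1}^n conj(z_l) · A_{lj} · z_j ≥ 0 (a nonnegative real number). Then the entrywise exponential matrix B with entries B_{lj} = exp(A_{lj}) is positive semidefinite: for all z_1, …, z_n ∈ ℂ, Σ_{l,j=1}^n conj(z_l) · B_{lj} · z_j is a nonnegative real number. -/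
open Complex ComplexOrder

open scoped Matrix

/-- The quadratic form of a matrix, written as a double sum. -/
theorem star_dotProduct_mulVec_eq_sum {ι : Type*} [Fintype ι] (M : Matrix ι ι ℂ) (z : ι → ℂ) :
    star z ⬝ᵥ (M *ᵥ z) = ∑ l, ∑ j, (starRingEnd ℂ) (z l) * M l j * z j := by
  simp [dotProduct, Matrix.mulVec, Finset.mul_sum, mul_assoc]

/-- Entrywise powers of a positive semidefinite matrix are positive semidefinite. -/
theorem Matrix.PosSemidef.map_pow {ι : Type*} [Fintype ι] {K : Matrix ι ι ℂ}
    (hK : K.PosSemidef) (m : ℕ) : (K.map (· ^ m)).PosSemidef := by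
  induction m with
  | zero =>
    convert Matrix.posSemidef_vecMulVec_self_star (fun _ : ι => (1 : ℂ)) using 1
    ext i j
    simp [Matrix.vecMulVec]
  | succ m ih =>
    have h : K.map (· ^ (m + 1)) = (K.map (· ^ m)).hadamard K := by
      ext i j
      simp [pow_succ]
    rw [h]
    exact ih.hadamard hK

/-- The entrywise exponential of a positive semidefinite matrix has a nonnegative
quadratic form. -/
theorem Matrix.PosSemidef.sum_exp_nonneg {ι : Type*} [Fintype ι] {K : Matrix ι ι ℂ}
    (hK : K.PosSemidef) (z : ι → ℂ) :
    0 ≤ ∑ l, ∑ j, (starRingEnd ℂ) (z l) * Complex.exp (K l j) * z j := by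
  have hsum : HasSum
      (fun m : ℕ => ∑ l, ∑ j, (starRingEnd ℂ) (z l) * ((m.factorial : ℂ)⁻¹ * K l j ^ m) * z j)
      (∑ l, ∑ j, (starRingEnd ℂ) (z l) * Complex.exp (K l j) * z j) := by
    refine hasSum_sum fun l _ => hasSum_sum fun j _ => ?_
    have h := NormedSpace.exp_series_hasSum_exp' (𝕂 := ℂ) (K l j)
    rw [← Complex.exp_eq_exp_ℂ] at h
    simpa only [smul_eq_mul] using (h.mul_left _).mul_right (z j)
  refine hsum.nonneg fun m => ?_
  have hpow := (hK.map_pow m).dotProduct_mulVec_nonneg z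
  rw [star_dotProduct_mulVec_eq_sum] at hpow
  have hfact : (0 : ℂ) ≤ (m.factorial : ℂ)⁻¹ := by
    rw [← Complex.ofReal_natCast, ← Complex.ofReal_inv]
    exact Complex.zero_le_real.mpr (by positivity)
  convert mul_nonneg hfact hpow using 1
  simp only [Finset.mul_sum, Matrix.map_apply]
  exact Finset.sum_congr rfl fun l _ => Finset.sum_congr rfl fun j _ => by ring

/-- Recentring a conditionally positive semidefinite matrix at an index makes it positive
semidefinite. -/
theorem posSemidef_recentre {ι : Type*} [Fintype ι] (A : Matrix ι ι ℂ)
    (hA : A.IsHermitian)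
    (hcond : ∀ z : ι → ℂ, ∑ j, z j = 0 →
      0 ≤ ∑ l, ∑ j, (starRingEnd ℂ) (z l) * A l j * z j) (i : ι) :
    (Matrix.of fun l j => A l j - A l i - A i j + A i i).PosSemidef := by
  classical
  refine .of_dotProduct_mulVec_nonneg ?_ fun z => ?_
  · ext l j
    simp only [Matrix.conjTranspose_apply, Matrix.of_apply, star_add, star_sub, hA.apply]
    ring
  · rw [star_dotProduct_mulVec_eq_sum]
    convert hcond (z - Pi.single i (∑ j, z j)) (by simp) using 1
    simp only [Matrix.of_apply, Pi.sub_apply, map_sub, mul_sub, sub_mul, mul_add, add_mul,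
      Finset.sum_sub_distrib, Finset.sum_add_distrib, Pi.single_apply, apply_ite (starRingEnd ℂ),
      map_zero, ite_mul, mul_ite, zero_mul, mul_zero, Finset.sum_ite_eq',
      Finset.mem_univ, if_true, map_sum, Finset.sum_mul, Finset.mul_sum, Finset.sum_ite_irrel,
      Finset.sum_const_zero]
    rw [Finset.sum_comm (f := fun l j => (starRingEnd ℂ) (z l) * A i j * z j),
      Finset.sum_comm (f := fun l j => (starRingEnd ℂ) (z l) * A i i * z j)]
    ring

/-- Matrix form of Schoenberg's theorem: the entrywise exponential of a Hermitian,
conditionally positive semidefinite matrix is positive semidefinite. -/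
theorem entrywise_exp_of_conditionally_posSemidef_is_posSemidef
    (n : ℕ) (hn : 1 ≤ n) (A : Matrix (Fin n) (Fin n) ℂ)
    (hHerm : ∀ l j : Fin n, A j l = (starRingEnd ℂ) (A l j))
    (hcond : ∀ z : Fin n → ℂ, ∑ j, z j = 0 →
      0 ≤ ∑ l : Fin n, ∑ j : Fin n, (starRingEnd ℂ) (z l) * A l j * z j) :
    ∀ z : Fin n → ℂ,
      0 ≤ ∑ l : Fin n, ∑ j : Fin n,
        (starRingEnd ℂ) (z l) * Complex.exp (A l j) * z j := by
  intro z
  let i : Fin n := ⟨0, hn⟩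
  have hA : A.IsHermitian := by
    ext l j
    exact (hHerm j l).symm
  convert (posSemidef_recentre A hA hcond i).sum_exp_nonneg
    (fun j => Complex.exp (A i j - A i i / 2) * z j) using 1
  refine Finset.sum_congr rfl fun l _ => Finset.sum_congr rfl fun j _ => ?_
  have hconj : (starRingEnd ℂ) (Complex.exp (A i l - A i i / 2)) =
      Complex.exp (A l i - A i i / 2) := by
    rw [← Complex.exp_conj, map_sub, map_div₀, ← hHerm, ← hHerm, map_ofNat]
  have hexp : Complex.exp (A l j) = Complex.exp (A l i - A i i / 2) *
      Complex.exp (A l j - A l i - A i j + A i i) * Complex.exp (A i j - A i i / 2) := by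
    rw [← Complex.exp_add, ← Complex.exp_add]
    congr 1
    ring
  rw [map_mul, hconj, Matrix.of_apply, hexp]
  ring
end

section
/- Let ψ be the Lévy characteristic associated with the triplet (a, σ, M). Then ψ is infinitely differentiable on ℝ^L (ψ is C^∞ as a function from ℝ^L to ℂ). -/
open MeasureTheory Complex

open scoped Real FourierTransform in
/-- The derivative of `w ↦ ∫ (𝐞 (-B v w) - 1) ∂μ` is a Fourier integral, for a measure with finite
first moment (but possibly infinite mass). -/
lemma hasFDerivAt_integral_fourierChar_sub_one {V W : Type*}
    [NormedAddCommGroup V] [NormedSpace ℝ V] [MeasurableSpace V] [BorelSpace V]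
    [SecondCountableTopology V] [NormedAddCommGroup W] [NormedSpace ℝ W]
    (B : V →L[ℝ] W →L[ℝ] ℝ) {μ : Measure V} (hμ : Integrable (fun v ↦ ‖v‖) μ) (w : W) :
    HasFDerivAt (fun w ↦ ∫ v, ((𝐞 (-B v w) : ℂ) - 1) ∂μ)
      (VectorFourier.fourierIntegral 𝐞 μ B.toLinearMap₁₂
        (VectorFourier.fourierSMulRight B fun _ ↦ (1 : ℂ)) w) w := by
  have hcont (w : W) : Continuous fun v ↦ (𝐞 (-B v w) : ℂ) :=
    continuous_subtype_val.comp (Real.continuous_fourierChar.comp (by fun_prop))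
  have hmeas (w : W) : AEStronglyMeasurable (fun v ↦ (𝐞 (-B v w) : ℂ) - 1) μ :=
    ((hcont w).sub continuous_const).aestronglyMeasurable
  refine hasFDerivAt_integral_of_dominated_of_fderiv_le
    (F' := fun w v ↦ (𝐞 (-B v w) : ℂ) • VectorFourier.fourierSMulRight B (fun _ ↦ (1 : ℂ)) v)
    (bound := fun v ↦ 2 * π * ‖B‖ * ‖v‖) Filter.univ_mem (.of_forall hmeas) ?_ ?_ ?_
    (hμ.const_mul _) ?_
  · refine (hμ.const_mul (2 * π * (‖B‖ * ‖w‖))).mono' (hmeas w) (.of_forall fun v ↦ ?_)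
    have h := Real.norm_exp_I_mul_ofReal_sub_one_le (x := 2 * π * -B v w)
    rw [Real.fourierChar_apply, mul_comm _ I]
    refine h.trans ?_
    rw [norm_mul, norm_neg, Real.norm_of_nonneg Real.two_pi_pos.le]
    calc 2 * π * ‖B v w‖ ≤ 2 * π * (‖B‖ * ‖v‖ * ‖w‖) := by
          gcongr
          exact B.le_opNorm₂ v w
      _ = 2 * π * (‖B‖ * ‖w‖) * ‖v‖ := by ring
  · exact (hcont w).aestronglyMeasurable.smul
      (aestronglyMeasurable_const.fourierSMulRight)
  · refine .of_forall fun v w _ ↦ ?_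
    rw [norm_smul, Circle.norm_coe, one_mul]
    simpa using VectorFourier.norm_fourierSMulRight_le B (fun _ ↦ (1 : ℂ)) v
  · refine .of_forall fun v w _ ↦ ?_
    have h := VectorFourier.hasFDerivAt_fourierChar_smul B (fun _ ↦ (1 : ℂ)) v w
    simpa [Circle.smul_def] using h.sub_const 1

open scoped Real FourierTransform ContDiff in
/-- If a (possibly infinite) measure has moments of all positive orders, then
`w ↦ ∫ (𝐞 (-B v w) - 1) ∂μ` is smooth. -/
lemma contDiff_integral_fourierChar_sub_one {V W : Type*}
    [NormedAddCommGroup V] [NormedSpace ℝ V] [MeasurableSpace V] [BorelSpace V]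
    [SecondCountableTopology V] [NormedAddCommGroup W] [NormedSpace ℝ W]
    (B : V →L[ℝ] W →L[ℝ] ℝ) {μ : Measure V}
    (hμ : ∀ k : ℕ, 1 ≤ k → Integrable (fun v ↦ ‖v‖ ^ k) μ) :
    ContDiff ℝ ∞ fun w ↦ ∫ v, ((𝐞 (-B v w) : ℂ) - 1) ∂μ := by
  have hderiv (w : W) := hasFDerivAt_integral_fourierChar_sub_one B
    (by simpa using hμ 1 le_rfl) w
  refine contDiff_infty_iff_fderiv.2 ⟨fun w ↦ (hderiv w).differentiableAt, ?_⟩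
  rw [funext fun w ↦ (hderiv w).fderiv]
  refine VectorFourier.contDiff_fourierIntegral B fun n _ ↦ ?_
  refine ((hμ (n + 1) (by lia)).const_mul (2 * π * ‖B‖)).mono' ?_ (.of_forall fun v ↦ ?_)
  · exact (by fun_prop : Continuous fun v : V ↦ ‖v‖ ^ n).aestronglyMeasurable.mul
      (aestronglyMeasurable_const.fourierSMulRight).norm
  · rw [norm_mul, norm_pow, norm_norm, norm_norm]
    calc ‖v‖ ^ n * ‖VectorFourier.fourierSMulRight B (fun _ ↦ (1 : ℂ)) v‖
        ≤ ‖v‖ ^ n * (2 * π * ‖B‖ * ‖v‖ * ‖(1 : ℂ)‖) := by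
          gcongr
          exact VectorFourier.norm_fourierSMulRight_le B (fun _ ↦ (1 : ℂ)) v
      _ = 2 * π * ‖B‖ * ‖v‖ ^ (n + 1) := by
          rw [norm_one]
          ring

/-- The Lévy characteristic of a triplet `(a, σ, M)` with `M` having moments of all
orders is a `C^∞` function on `ℝ^L`. -/
theorem levyChar_contDiff
    (L : ℕ) (hL : 1 ≤ L)
    (a : Fin L → ℝ) (σ : Matrix (Fin L) (Fin L) ℝ)
    (hσsymm : σ.IsSymm) (hσpos : σ.PosSemidef)
    (M : Measure (Fin L → ℝ)) (hM0 : M {0} = 0)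
    (hMmom : ∀ k : ℕ, 1 ≤ k → Integrable (fun s => ‖s‖ ^ k) M) :
    ContDiff ℝ (⊤ : ℕ∞) (levyChar L a σ M) := by
  let B : (Fin L → ℝ) →L[ℝ] (Fin L → ℝ) →L[ℝ] ℝ :=
    (-(2 * Real.pi)⁻¹) • ∑ i, (ContinuousLinearMap.proj (R := ℝ) i).smulRight
      (ContinuousLinearMap.proj (R := ℝ) (φ := fun _ : Fin L ↦ ℝ) i)
  have hB (s t : Fin L → ℝ) : 2 * Real.pi * -B s t = ∑ i, t i * s i := by
    have hπ := Real.pi_ne_zero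
    simp only [B, smul_apply, sum_apply,
      ContinuousLinearMap.smulRight_apply, ContinuousLinearMap.proj_apply, smul_eq_mul]
    field_simp
    simp [mul_comm]
  have hint := contDiff_integral_fourierChar_sub_one B hMmom
  simp only [Real.fourierChar_apply, hB, mul_comm _ I] at hint
  have hofReal {f : (Fin L → ℝ) → ℝ} (hf : ContDiff ℝ (⊤ : ℕ∞) f) :
      ContDiff ℝ (⊤ : ℕ∞) fun t ↦ (f t : ℂ) := ofRealCLM.contDiff.comp hf
  refine ((contDiff_const.mul (hofReal ?_)).sub (hofReal ?_)).add hint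
  · fun_prop
  · simp only [Matrix.mulVec, dotProduct]
    fun_prop
end
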